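/- Let G : ℝ² → ℝ² be a continuously differentiable unipotent map. Then there exist real numbers a, b, c, d and a continuously differentiable function φ : ℝ → ℝ such that G(x,y) = (x + b·φ(a·x + b·y) + c, y − a·φ(a·x + b·y) + d) for all (x,y) ∈ ℝ². -/

import Mathlib

open Filter Topology

/-- A differentiable planar map is *unipotent* if at every point the Jacobian has
both eigenvalues equal to `1`; equivalently the trace of the Jacobian is `2` and
its determinant is `1` everywhere. -/
def Unipotent (G : ℝ × ℝ → ℝ × ℝ) : Prop :=
  ∀ z : ℝ × ℝ,
    (fderiv ℝ G z (1, 0)).1 + (fderiv ℝ G z (0, 1)).2 = 2 ∧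
    (fderiv ℝ G z (1, 0)).1 * (fderiv ℝ G z (0, 1)).2 -
      (fderiv ℝ G z (0, 1)).1 * (fderiv ℝ G z (1, 0)).2 = 1

/-- A planar map is *nonlinear* if its derivative is not constant, i.e. it is not affine. -/
def NonlinearMap (G : ℝ × ℝ → ℝ × ℝ) : Prop :=
  ¬ ∃ A : (ℝ × ℝ) →L[ℝ] ℝ × ℝ, ∀ z : ℝ × ℝ, fderiv ℝ G z = A

/-- A real function is *nonlinear* if it is not of the form `t ↦ k * t`. -/
def NonlinearFun (ψ : ℝ → ℝ) : Prop :=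
  ¬ ∃ k : ℝ, ∀ t : ℝ, ψ t = k * t

/-- The linear rotation by angle `θ`. -/
noncomputable def Rot (θ : ℝ) (p : ℝ × ℝ) : ℝ × ℝ :=
  (p.1 * Real.cos θ - p.2 * Real.sin θ, p.1 * Real.sin θ + p.2 * Real.cos θ)

/-- A function which is locally of the form `1 / affine` wherever it is nonzero
(and satisfies an auxiliary closed condition) never vanishes. -/
theorem ne_zero_of_locally_inv_affine {f : ℝ → ℝ} (hf : Continuous f) {C : Set ℝ}
    (hC : IsClosed C) {t₀ : ℝ} (h₀ : f t₀ ≠ 0 ∧ t₀ ∈ C)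
    (hloc : ∀ t, f t ≠ 0 → t ∈ C → ∃ k : ℝ, ∀ᶠ s in 𝓝 t,
      (f s ≠ 0 ∧ s ∈ C) ∧ (f s)⁻¹ = (f t)⁻¹ + k * (s - t)) (t : ℝ) :
    f t ≠ 0 ∧ t ∈ C := by
  set S : Set ℝ := {t | f t ≠ 0 ∧ t ∈ C} with hS
  have hSo : IsOpen S := by
    rw [isOpen_iff_mem_nhds]
    rintro t ⟨h1, h2⟩
    obtain ⟨k, hk⟩ := hloc t h1 h2
    filter_upwards [hk] with s hs using hs.1
  set I := connectedComponentIn S t₀ with hI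
  have h₀I : t₀ ∈ I := mem_connectedComponentIn h₀
  have hIS : I ⊆ S := connectedComponentIn_subset S t₀
  have hIo : IsOpen I := hSo.connectedComponentIn
  have hIc : IsPreconnected I := isPreconnected_connectedComponentIn
  set g : ℝ → ℝ := fun t => (f t)⁻¹ with hg
  have hder : ∀ t ∈ I, ∃ k, ∀ᶠ s in 𝓝 t, HasDerivAt g k s := by
    intro t ht
    obtain ⟨k, hk⟩ := hloc t (hIS ht).1 (hIS ht).2
    refine ⟨k, ?_⟩
    filter_upwards [hk.eventually_nhds] with s hs
    have h1 : HasDerivAt (fun s => (f t)⁻¹ + k * (s - t)) k s := by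
      simpa using (((hasDerivAt_id s).sub_const t).const_mul k).const_add ((f t)⁻¹)
    exact h1.congr_of_eventuallyEq (hs.mono fun u hu => hu.2)
  have hdd : ∀ t ∈ I, HasDerivAt (deriv g) 0 t := by
    intro t ht
    obtain ⟨k, hk⟩ := hder t ht
    exact (hasDerivAt_const t k).congr_of_eventuallyEq (hk.mono fun u hu => hu.deriv)
  have hd : ∀ t ∈ I, HasDerivAt g (deriv g t₀) t := by
    intro t ht
    obtain ⟨k, hk⟩ := hder t ht
    have : deriv g t = deriv g t₀ := hIo.is_const_of_deriv_eq_zero hIc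
      (fun s hs => (hdd s hs).differentiableAt.differentiableWithinAt)
      (fun s hs => (hdd s hs).deriv) ht h₀I
    rw [← this]
    exact hk.self_of_nhds.differentiableAt.hasDerivAt
  have haff : ∀ t ∈ I, f t * (g t₀ + deriv g t₀ * (t - t₀)) = 1 := by
    intro t ht
    have hd' : ∀ s ∈ I, HasDerivAt (fun s => g s - deriv g t₀ * (s - t₀)) 0 s := by
      intro s hs
      have h2 := (hd s hs).fun_sub (((hasDerivAt_id s).sub_const t₀).const_mul (deriv g t₀))
      simpa using h2
    have h1 := hIo.is_const_of_deriv_eq_zero hIc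
      (fun s hs => (hd' s hs).differentiableAt.differentiableWithinAt)
      (fun s hs => (hd' s hs).deriv) ht h₀I
    have h2 : g t₀ + deriv g t₀ * (t - t₀) = g t := by
      simp only [sub_self, mul_zero, sub_zero] at h1
      linarith
    rw [h2]
    exact mul_inv_cancel₀ (hIS ht).1
  have hIcl : IsClosed I := by
    refine isClosed_of_closure_subset ?_
    refine IsPreconnected.subset_connectedComponentIn hIc.closure (subset_closure h₀I) ?_
    intro t ht
    have h1 : f t * (g t₀ + deriv g t₀ * (t - t₀)) = 1 :=
      closure_minimal haff (isClosed_eq (by fun_prop) continuous_const) ht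
    exact ⟨left_ne_zero_of_mul_eq_one h1, closure_minimal (fun s hs => (hIS hs).2) hC ht⟩
  have hu : I = Set.univ := IsClopen.eq_univ ⟨hIcl, hIo⟩ ⟨t₀, h₀I⟩
  exact hIS (hu ▸ Set.mem_univ t)

/-- A linear form on the plane in terms of its values on the standard basis. -/
theorem apply_eq_partials (L : ℝ × ℝ →L[ℝ] ℝ) (v : ℝ × ℝ) :
    L v = v.1 * L (1, 0) + v.2 * L (0, 1) := by
  have h : v = v.1 • ((1 : ℝ), (0 : ℝ)) + v.2 • ((0 : ℝ), (1 : ℝ)) := by ext <;> simp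
  calc L v = L (v.1 • ((1 : ℝ), (0 : ℝ)) + v.2 • ((0 : ℝ), (1 : ℝ))) := by rw [← h]
    _ = _ := by rw [map_add, map_smul, map_smul, smul_eq_mul, smul_eq_mul]

/-- Near a point where `∂P/∂x ≠ 0`, the abscissa is a differentiable function of the value of
`P` and of the ordinate. -/
theorem exists_abscissa {P : ℝ × ℝ → ℝ} (hP : ContDiff ℝ 1 P) {r : ℝ × ℝ}
    (hr : fderiv ℝ P r (1, 0) ≠ 0) :
    ∃ ε > 0, ∃ X : ℝ × ℝ → ℝ, X (P r, r.2) = r.1 ∧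
      ∀ c ∈ Metric.ball (P r) ε, ∀ y ∈ Metric.ball r.2 ε, DifferentiableAt ℝ X (c, y) ∧
        P (X (c, y), y) = c := by
  set a := fderiv ℝ P r (1, 0) with ha
  set b := fderiv ℝ P r (0, 1) with hb
  have hlin : ∀ v : ℝ × ℝ, fderiv ℝ P r v = v.1 * a + v.2 * b :=
    fun v => apply_eq_partials (fderiv ℝ P r) v
  let e : (ℝ × ℝ) ≃L[ℝ] ℝ × ℝ := ContinuousLinearEquiv.equivOfInverse
    ((fderiv ℝ P r).prod (ContinuousLinearMap.snd ℝ ℝ ℝ))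
    ((a⁻¹ • (ContinuousLinearMap.fst ℝ ℝ ℝ - b • ContinuousLinearMap.snd ℝ ℝ ℝ)).prod
      (ContinuousLinearMap.snd ℝ ℝ ℝ))
    (by intro v; ext <;> simp [hlin]; field_simp; ring)
    (by intro v; ext <;> simp [hlin]; field_simp; ring)
  have hc : ContDiffAt ℝ 1 (fun z : ℝ × ℝ => (P z, z.2)) r := by fun_prop
  have hd : HasFDerivAt (fun z : ℝ × ℝ => (P z, z.2)) (e : (ℝ × ℝ) →L[ℝ] ℝ × ℝ) r :=
    ((hP.differentiable one_ne_zero r).hasFDerivAt).prodMk hasFDerivAt_snd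
  have hs : HasStrictFDerivAt (fun z : ℝ × ℝ => (P z, z.2)) (e : (ℝ × ℝ) →L[ℝ] ℝ × ℝ) r :=
    hc.hasStrictFDerivAt' hd one_ne_zero
  set ψ := hc.localInverse hd one_ne_zero with hψ
  have h1 : ContDiffAt ℝ 1 ψ (P r, r.2) := hc.to_localInverse hd one_ne_zero
  have h2 : ∀ᶠ w in 𝓝 (P r, r.2), (P (ψ w), (ψ w).2) = w := hs.eventually_right_inverse
  have h3 : ∀ᶠ w in 𝓝 (P r, r.2), DifferentiableAt ℝ ψ w :=
    (h1.eventually (by simp)).mono fun w hw => hw.differentiableAt one_ne_zero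
  have h4 : ψ (P r, r.2) = r := hs.localInverse_apply_image
  obtain ⟨ε, hε, hball⟩ := Metric.eventually_nhds_iff_ball.1 (h2.and h3)
  refine ⟨ε, hε, fun w => (ψ w).1, congrArg Prod.fst h4, fun c hc' y hy => ?_⟩
  obtain ⟨h5, h6⟩ := hball (c, y) (by rw [← ball_prod_same]; exact ⟨hc', hy⟩)
  refine ⟨h6.fst, ?_⟩
  have h7 := congrArg Prod.fst h5
  have h8 := congrArg Prod.snd h5
  simp only at h7 h8
  have : ((ψ (c, y)).1, y) = ψ (c, y) := by ext <;> simp [h8]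
  rw [this, h7]

/-- Near a point where `∂P/∂x ≠ 0`, the level curve of `P` is a segment on which the direction of
the kernel is constant and `(∂P/∂x)⁻¹` is affine. -/
theorem exists_inv_affine_near {P Q : ℝ × ℝ → ℝ} (hP : ContDiff ℝ 1 P) (hQ : ContDiff ℝ 1 Q)
    (h₁ : ∀ z, fderiv ℝ P z (0, 1) = fderiv ℝ Q z (1, 0))
    (h₂ : ∀ z, fderiv ℝ P z (1, 0) * fderiv ℝ Q z (0, 1) = fderiv ℝ P z (0, 1) ^ 2)
    {x₀ y₀ m : ℝ} (hr : fderiv ℝ P (x₀, y₀) (1, 0) ≠ 0)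
    (hm : fderiv ℝ P (x₀, y₀) (0, 1) = -m * fderiv ℝ P (x₀, y₀) (1, 0)) :
    ∃ k : ℝ, ∀ᶠ y in 𝓝 y₀,
      (fderiv ℝ P (x₀ + m * (y - y₀), y) (1, 0) ≠ 0 ∧
        fderiv ℝ P (x₀ + m * (y - y₀), y) (0, 1) =
          -m * fderiv ℝ P (x₀ + m * (y - y₀), y) (1, 0)) ∧
      (fderiv ℝ P (x₀ + m * (y - y₀), y) (1, 0))⁻¹ =
        (fderiv ℝ P (x₀, y₀) (1, 0))⁻¹ + k * (y - y₀) := by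
  obtain ⟨ε, hε, X, hX₀, hX⟩ := exists_abscissa hP hr
  set c₀ := P (x₀, y₀) with hc₀
  simp only at hX₀ hX
  set U := Metric.ball c₀ ε
  set W := Metric.ball y₀ ε
  have hc₀U : c₀ ∈ U := Metric.mem_ball_self hε
  have hy₀W : y₀ ∈ W := Metric.mem_ball_self hε
  have hUo : IsOpen U := Metric.isOpen_ball
  have hWo : IsOpen W := Metric.isOpen_ball
  have hWc : IsPreconnected W := (convex_ball y₀ ε).isPreconnected
  -- partial derivatives of `X` and of compositions with `X`
  have hXc : ∀ c ∈ U, ∀ y ∈ W, HasDerivAt (fun c => X (c, y)) (fderiv ℝ X (c, y) (1, 0)) c := by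
    intro c hc y hy
    exact (hX c hc y hy).1.hasFDerivAt.comp_hasDerivAt c
      ((hasDerivAt_id c).prodMk (hasDerivAt_const c y))
  have hXy : ∀ c ∈ U, ∀ y ∈ W, HasDerivAt (fun y => X (c, y)) (fderiv ℝ X (c, y) (0, 1)) y := by
    intro c hc y hy
    exact (hX c hc y hy).1.hasFDerivAt.comp_hasDerivAt y
      ((hasDerivAt_const y c).prodMk (hasDerivAt_id y))
  have hRc : ∀ R : ℝ × ℝ → ℝ, ContDiff ℝ 1 R → ∀ c ∈ U, ∀ y ∈ W,
      HasDerivAt (fun c => R (X (c, y), y))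
        (fderiv ℝ X (c, y) (1, 0) * fderiv ℝ R (X (c, y), y) (1, 0)) c := by
    intro R hR c hc y hy
    have h := (hR.differentiable one_ne_zero (X (c, y), y)).hasFDerivAt.comp_hasDerivAt c
      ((hXc c hc y hy).prodMk (hasDerivAt_const c y))
    rw [apply_eq_partials] at h
    simpa [Function.comp_def] using h
  have hRy : ∀ R : ℝ × ℝ → ℝ, ContDiff ℝ 1 R → ∀ c ∈ U, ∀ y ∈ W,
      HasDerivAt (fun y => R (X (c, y), y))
        (fderiv ℝ X (c, y) (0, 1) * fderiv ℝ R (X (c, y), y) (1, 0) +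
          fderiv ℝ R (X (c, y), y) (0, 1)) y := by
    intro R hR c hc y hy
    have h := HasFDerivAt.comp_hasDerivAt (f := fun s => (X (c, s), s)) y
      (hR.differentiable one_ne_zero (X (c, y), y)).hasFDerivAt
      ((hXy c hc y hy).prodMk (hasDerivAt_id y))
    rw [apply_eq_partials] at h
    simpa [Function.comp_def] using h
  have hPc : ∀ c ∈ U, ∀ y ∈ W,
      fderiv ℝ X (c, y) (1, 0) * fderiv ℝ P (X (c, y), y) (1, 0) = 1 := by
    intro c hc y hy
    refine (hRc P hP c hc y hy).unique ((hasDerivAt_id c).congr_of_eventuallyEq ?_)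
    filter_upwards [hUo.mem_nhds hc] with c' hc' using (hX c' hc' y hy).2
  have hPy : ∀ c ∈ U, ∀ y ∈ W, fderiv ℝ P (X (c, y), y) (0, 1) =
      -fderiv ℝ X (c, y) (0, 1) * fderiv ℝ P (X (c, y), y) (1, 0) := by
    intro c hc y hy
    have h := (hRy P hP c hc y hy).unique ((hasDerivAt_const y c).congr_of_eventuallyEq
      (by filter_upwards [hWo.mem_nhds hy] with y' hy' using (hX c hc y' hy').2))
    linarith
  have hPx : ∀ c ∈ U, ∀ y ∈ W, fderiv ℝ P (X (c, y), y) (1, 0) ≠ 0 :=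
    fun c hc y hy => right_ne_zero_of_mul_eq_one (hPc c hc y hy)
  -- `Q` is a function of `P`
  have hQy : ∀ c ∈ U, ∀ y ∈ W, HasDerivAt (fun y => Q (X (c, y), y)) 0 y := by
    intro c hc y hy
    convert hRy Q hQ c hc y hy using 1
    have e1 := h₂ (X (c, y), y)
    have e2 := hPy c hc y hy
    rw [← h₁]
    apply mul_left_cancel₀ (hPx c hc y hy)
    rw [mul_add, e1, e2]
    ring
  have hQconst : ∀ c ∈ U, ∀ y ∈ W, Q (X (c, y), y) = Q (X (c, y₀), y₀) := fun c hc y hy =>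
    hWo.is_const_of_deriv_eq_zero (f := fun y => Q (X (c, y), y)) hWc
      (fun s hs => (hQy c hc s hs).differentiableAt.differentiableWithinAt)
      (fun s hs => (hQy c hc s hs).deriv) hy hy₀W
  have hQc : ∀ c ∈ U, ∀ y ∈ W,
      fderiv ℝ X (c, y) (1, 0) * fderiv ℝ Q (X (c, y), y) (1, 0) = -fderiv ℝ X (c, y) (0, 1) := by
    intro c hc y hy
    rw [← h₁, hPy c hc y hy]
    linear_combination (-fderiv ℝ X (c, y) (0, 1)) * hPc c hc y hy
  have hslope : ∀ c ∈ U, ∀ y ∈ W, fderiv ℝ X (c, y) (0, 1) = fderiv ℝ X (c, y₀) (0, 1) := by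
    intro c hc y hy
    have h := (hRc Q hQ c hc y hy).unique ((hRc Q hQ c hc y₀ hy₀W).congr_of_eventuallyEq
      (by filter_upwards [hUo.mem_nhds hc] with c' hc' using hQconst c' hc' y hy))
    rw [hQc c hc y hy, hQc c hc y₀ hy₀W] at h
    exact neg_injective h
  have haff : ∀ c ∈ U, ∀ y ∈ W,
      X (c, y) = X (c, y₀) + fderiv ℝ X (c, y₀) (0, 1) * (y - y₀) := by
    intro c hc y hy
    have hd : ∀ s ∈ W,
        HasDerivAt (fun y => X (c, y) - fderiv ℝ X (c, y₀) (0, 1) * (y - y₀)) 0 s := by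
      intro s hs
      have h := (hXy c hc s hs).fun_sub
        (((hasDerivAt_id s).sub_const y₀).const_mul (fderiv ℝ X (c, y₀) (0, 1)))
      rw [hslope c hc s hs] at h
      simpa using h
    have h := hWo.is_const_of_deriv_eq_zero hWc
      (fun s hs => (hd s hs).differentiableAt.differentiableWithinAt)
      (fun s hs => (hd s hs).deriv) hy hy₀W
    simp only [sub_self, mul_zero, sub_zero] at h
    linarith
  have hm' : fderiv ℝ X (c₀, y₀) (0, 1) = m := by
    have h := hPy c₀ hc₀U y₀ hy₀W
    rw [hX₀, hm] at h
    exact (neg_injective (mul_right_cancel₀ hr h)).symm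
  have hline : ∀ y ∈ W, X (c₀, y) = x₀ + m * (y - y₀) := by
    intro y hy
    rw [haff c₀ hc₀U y hy, hm', hX₀]
  have hinv : ∀ y ∈ W,
      (fderiv ℝ P (x₀ + m * (y - y₀), y) (1, 0))⁻¹ = fderiv ℝ X (c₀, y) (1, 0) := by
    intro y hy
    rw [← hline y hy]
    exact (eq_inv_of_mul_eq_one_left (hPc c₀ hc₀U y hy)).symm
  -- the derivative in `c` of an affine function of `y` is affine in `y`
  have hhW : y₀ + ε / 2 ∈ W := by
    simp [W, abs_of_pos hε, hε]
  refine ⟨(fderiv ℝ X (c₀, y₀ + ε / 2) (1, 0) - fderiv ℝ X (c₀, y₀) (1, 0)) / (ε / 2), ?_⟩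
  filter_upwards [hWo.mem_nhds hy₀W] with y hy
  refine ⟨⟨hline y hy ▸ hPx c₀ hc₀U y hy, ?_⟩, ?_⟩
  · have h := hPy c₀ hc₀U y hy
    rwa [hslope c₀ hc₀U y hy, hm', hline y hy] at h
  · rw [hinv y hy]
    have h0 := hinv y₀ hy₀W
    simp only [sub_self, mul_zero, add_zero] at h0
    rw [h0]
    have h := ((hXc c₀ hc₀U _ hhW).fun_sub (hXc c₀ hc₀U y₀ hy₀W)).div_const (ε / 2)
    have h' := (hXc c₀ hc₀U y₀ hy₀W).fun_add (h.mul_const (y - y₀))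
    refine (hXc c₀ hc₀U y hy).unique (h'.congr_of_eventuallyEq ?_)
    filter_upwards [hUo.mem_nhds hc₀U] with c hc
    rw [haff c hc y hy, haff c hc _ hhW]
    field_simp
    ring

/-- Through a point where `∂P/∂x ≠ 0` there is a whole line on which the direction of the kernel
is constant. -/
theorem partials_on_line {P Q : ℝ × ℝ → ℝ} (hP : ContDiff ℝ 1 P) (hQ : ContDiff ℝ 1 Q)
    (h₁ : ∀ z, fderiv ℝ P z (0, 1) = fderiv ℝ Q z (1, 0))
    (h₂ : ∀ z, fderiv ℝ P z (1, 0) * fderiv ℝ Q z (0, 1) = fderiv ℝ P z (0, 1) ^ 2)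
    {x₀ y₀ m : ℝ} (hr : fderiv ℝ P (x₀, y₀) (1, 0) ≠ 0)
    (hm : fderiv ℝ P (x₀, y₀) (0, 1) = -m * fderiv ℝ P (x₀, y₀) (1, 0)) (y : ℝ) :
    fderiv ℝ P (x₀ + m * (y - y₀), y) (1, 0) ≠ 0 ∧
      fderiv ℝ P (x₀ + m * (y - y₀), y) (0, 1) =
        -m * fderiv ℝ P (x₀ + m * (y - y₀), y) (1, 0) := by
  have hc : ∀ v : ℝ × ℝ, Continuous fun y : ℝ => fderiv ℝ P (x₀ + m * (y - y₀), y) v := by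
    intro v
    have := hP.continuous_fderiv one_ne_zero
    fun_prop
  refine ne_zero_of_locally_inv_affine (hc (1, 0))
    (C := {y | fderiv ℝ P (x₀ + m * (y - y₀), y) (0, 1) =
        -m * fderiv ℝ P (x₀ + m * (y - y₀), y) (1, 0)})
    (isClosed_eq (hc (0, 1)) (continuous_const.mul (hc (1, 0)))) (t₀ := y₀)
    (by simp only [sub_self, mul_zero, add_zero, Set.mem_ofPred_eq]; exact ⟨hr, hm⟩) ?_ y
  intro t ht htC
  obtain ⟨k, hk⟩ := exists_inv_affine_near hP hQ h₁ h₂ ht htC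
  refine ⟨k, hk.mono fun s hs => ?_⟩
  have e : x₀ + m * (t - y₀) + m * (s - t) = x₀ + m * (s - y₀) := by ring
  rwa [e] at hs

/-- If `(P, Q)` is a gradient field with singular Jacobian, the kernels of its Jacobians contain a common
direction. -/
theorem exists_common_kernel {P Q : ℝ × ℝ → ℝ} (hP : ContDiff ℝ 1 P) (hQ : ContDiff ℝ 1 Q)
    (h₁ : ∀ z, fderiv ℝ P z (0, 1) = fderiv ℝ Q z (1, 0))
    (h₂ : ∀ z, fderiv ℝ P z (1, 0) * fderiv ℝ Q z (0, 1) = fderiv ℝ P z (0, 1) ^ 2) :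
    ∃ a b : ℝ, 0 < a ^ 2 + b ^ 2 ∧ ∀ z,
      b * fderiv ℝ P z (1, 0) = a * fderiv ℝ P z (0, 1) ∧
      b * fderiv ℝ Q z (1, 0) = a * fderiv ℝ Q z (0, 1) := by
  by_cases hV : ∃ z, fderiv ℝ P z (1, 0) ≠ 0
  swap
  · push Not at hV
    have hy : ∀ z, fderiv ℝ P z (0, 1) = 0 := fun z => by simpa [hV z] using (h₂ z).symm
    exact ⟨0, 1, by norm_num, fun z => by simp [hV z, ← h₁ z, hy z]⟩
  obtain ⟨⟨x₀, y₀⟩, hr⟩ := hV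
  obtain ⟨m, hm⟩ : ∃ m, fderiv ℝ P (x₀, y₀) (0, 1) = -m * fderiv ℝ P (x₀, y₀) (1, 0) :=
    ⟨-(fderiv ℝ P (x₀, y₀) (0, 1) / fderiv ℝ P (x₀, y₀) (1, 0)), by field_simp⟩
  have hline := partials_on_line hP hQ h₁ h₂ hr hm
  refine ⟨-1, m, by positivity, ?_⟩
  rintro ⟨x₁, y₁⟩
  by_cases hz : fderiv ℝ P (x₁, y₁) (1, 0) = 0
  · have hy : fderiv ℝ P (x₁, y₁) (0, 1) = 0 := by simpa [hz] using (h₂ (x₁, y₁)).symm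
    have hq : fderiv ℝ Q (x₁, y₁) (0, 1) = 0 := by
      by_contra hq
      have hsw : ∀ R : ℝ × ℝ → ℝ, ContDiff ℝ 1 R → ∀ x y : ℝ, ∀ v : ℝ × ℝ,
          fderiv ℝ (fun z : ℝ × ℝ => R z.swap) (x, y) v = fderiv ℝ R (y, x) v.swap := by
        intro R hR x y v
        have h := (ContinuousLinearEquiv.prodComm ℝ ℝ ℝ).comp_right_fderiv (f := R) (x := (x, y))
        exact congrArg (fun L => L v) h
      have hsm : ∀ R : ℝ × ℝ → ℝ, ContDiff ℝ 1 R →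
          ContDiff ℝ 1 (fun z : ℝ × ℝ => R z.swap) := fun R hR =>
        hR.comp (contDiff_snd.prodMk contDiff_fst)
      have hl := partials_on_line (P := fun z => Q z.swap) (Q := fun z => P z.swap)
        (hsm Q hQ) (hsm P hP)
        (by rintro ⟨x, y⟩; rw [hsw Q hQ, hsw P hP]; exact (h₁ (y, x)).symm)
        (by
          rintro ⟨x, y⟩
          rw [hsw Q hQ, hsw P hP, hsw Q hQ]
          simpa [mul_comm, h₁] using h₂ (y, x))
        (x₀ := y₁) (y₀ := x₁) (m := 0)
        (by rw [hsw Q hQ]; exact hq)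
        (by rw [hsw Q hQ, hsw Q hQ]; simp [← h₁, hy]) (x₀ + m * (y₁ - y₀))
      rw [hsw Q hQ, hsw Q hQ] at hl
      simp only [zero_mul, add_zero, neg_zero, Prod.swap_prod_mk] at hl
      have h3 := h₂ (x₀ + m * (y₁ - y₀), y₁)
      rw [h₁, hl.2] at h3
      exact mul_ne_zero (hline y₁).1 hl.1 (by simpa using h3)
    simp [hz, hy, hq, ← h₁]
  · obtain ⟨m', hm'⟩ : ∃ m', fderiv ℝ P (x₁, y₁) (0, 1) = -m' * fderiv ℝ P (x₁, y₁) (1, 0) :=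
      ⟨-(fderiv ℝ P (x₁, y₁) (0, 1) / fderiv ℝ P (x₁, y₁) (1, 0)), by field_simp⟩
    have hline' := partials_on_line hP hQ h₁ h₂ hz hm'
    have hmm : m' = m := by
      by_contra hne
      have hne' : m' - m ≠ 0 := sub_ne_zero.2 hne
      obtain ⟨y, hy⟩ : ∃ y, x₁ + m' * (y - y₁) = x₀ + m * (y - y₀) :=
        ⟨(x₀ - x₁ + m' * y₁ - m * y₀) / (m' - m), by field_simp; ring⟩
      have e := (hline' y).2
      rw [hy, (hline y).2] at e
      exact hne (neg_injective (mul_right_cancel₀ (hline y).1 e)).symm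
    subst hmm
    have h3 := h₂ (x₁, y₁)
    refine ⟨by linarith, ?_⟩
    rw [← h₁, hm']
    apply mul_left_cancel₀ hz
    rw [hm'] at h3
    linear_combination h3

/-- A function whose derivative in the direction `w` vanishes is constant along `w`. -/
theorem eq_of_fderiv_apply_eq_zero {R : ℝ × ℝ → ℝ} (hR : Differentiable ℝ R) {w : ℝ × ℝ}
    (hw : ∀ z, fderiv ℝ R z w = 0) (z : ℝ × ℝ) (t : ℝ) : R (z + t • w) = R z := by
  have hd : ∀ s : ℝ, HasDerivAt (fun s : ℝ => R (z + s • w)) 0 s := by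
    intro s
    have h := (hR (z + s • w)).hasFDerivAt.comp_hasDerivAt s
      (((hasDerivAt_id s).smul_const w).const_add z)
    simpa [hw, Function.comp_def] using h
  simpa using is_const_of_deriv_eq_zero (fun s => (hd s).differentiableAt)
    (fun s => (hd s).deriv) t 0

/-- every `C¹` unipotent planar map has the Campbell normal form. -/
theorem statement1 (G : ℝ × ℝ → ℝ × ℝ) (hG : ContDiff ℝ 1 G) (hU : Unipotent G) :
    ∃ (a b c d : ℝ) (φ : ℝ → ℝ), ContDiff ℝ 1 φ ∧
      ∀ x y : ℝ,
        G (x, y) = (x + b * φ (a * x + b * y) + c, y - a * φ (a * x + b * y) + d) := by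
  set P : ℝ × ℝ → ℝ := fun z => z.2 - (G z).2 with hPdef
  set Q : ℝ × ℝ → ℝ := fun z => (G z).1 - z.1 with hQdef
  have hP : ContDiff ℝ 1 P := by fun_prop
  have hQ : ContDiff ℝ 1 Q := by fun_prop
  have hPd := hP.differentiable one_ne_zero
  have hQd := hQ.differentiable one_ne_zero
  have hdP : ∀ z v, fderiv ℝ P z v = v.2 - (fderiv ℝ G z v).2 := by
    intro z v
    have hg := (hG.differentiable one_ne_zero z).hasFDerivAt
    have h : HasFDerivAt P _ z := hasFDerivAt_snd.fun_sub hg.snd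
    rw [h.fderiv]
    simp
  have hdQ : ∀ z v, fderiv ℝ Q z v = (fderiv ℝ G z v).1 - v.1 := by
    intro z v
    have hg := (hG.differentiable one_ne_zero z).hasFDerivAt
    have h : HasFDerivAt Q _ z := hg.fst.fun_sub hasFDerivAt_fst
    rw [h.fderiv]
    simp
  have h₁ : ∀ z, fderiv ℝ P z (0, 1) = fderiv ℝ Q z (1, 0) := by
    intro z
    rw [hdP, hdQ]
    linarith [(hU z).1]
  have h₂ : ∀ z, fderiv ℝ P z (1, 0) * fderiv ℝ Q z (0, 1) = fderiv ℝ P z (0, 1) ^ 2 := by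
    intro z
    have e := h₁ z
    rw [hdP, hdQ] at e
    rw [hdP, hdQ, hdP]
    linear_combination (hU z).2 - (hU z).1 - (1 - (fderiv ℝ G z (0, 1)).2) * e
  obtain ⟨a, b, hD, hker⟩ := exists_common_kernel hP hQ h₁ h₂
  have hD' : a ^ 2 + b ^ 2 ≠ 0 := hD.ne'
  have hwP : ∀ z, fderiv ℝ P z (b, -a) = 0 := fun z => by
    rw [apply_eq_partials]
    linear_combination (hker z).1
  have hwQ : ∀ z, fderiv ℝ Q z (b, -a) = 0 := fun z => by
    rw [apply_eq_partials]
    linear_combination (hker z).2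
  have hK : ∀ z, a * Q z - b * P z = a * Q 0 - b * P 0 := by
    intro z
    refine is_const_of_fderiv_eq_zero (𝕜 := ℝ) (f := fun z => a * Q z - b * P z) (by fun_prop)
      (fun z => ?_) z 0
    have h : HasFDerivAt (fun z => a * Q z - b * P z) _ z :=
      ((hQd z).hasFDerivAt.const_mul a).fun_sub ((hPd z).hasFDerivAt.const_mul b)
    rw [h.fderiv]
    refine ContinuousLinearMap.ext fun v => ?_
    rw [apply_eq_partials]
    have e1 := (hker z).1
    have e2 := (hker z).2
    have e3 := h₁ z
    simp only [sub_apply, smul_apply, smul_eq_mul,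
      zero_apply]
    linear_combination (-v.1) * e1 - v.2 * e2 - (v.1 * a + v.2 * b) * e3
  set K := a * Q 0 - b * P 0 with hKdef
  set n : ℝ → ℝ × ℝ := fun s => (s * a / (a ^ 2 + b ^ 2), s * b / (a ^ 2 + b ^ 2)) with hn
  have hnC : ContDiff ℝ 1 n := by fun_prop
  refine ⟨a, b, a * K / (a ^ 2 + b ^ 2), b * K / (a ^ 2 + b ^ 2),
    fun s => (b * Q (n s) + a * P (n s)) / (a ^ 2 + b ^ 2), by fun_prop, fun x y => ?_⟩
  have hproj : n (a * x + b * y) =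
      (x, y) + ((a * y - b * x) / (a ^ 2 + b ^ 2)) • ((b, -a) : ℝ × ℝ) := by
    simp only [hn]
    ext
    · simp; field_simp; ring
    · simp; field_simp; ring
  have hPn : P (n (a * x + b * y)) = P (x, y) := by
    rw [hproj, eq_of_fderiv_apply_eq_zero hPd hwP]
  have hQn : Q (n (a * x + b * y)) = Q (x, y) := by
    rw [hproj, eq_of_fderiv_apply_eq_zero hQd hwQ]
  have hk := hK (x, y)
  simp only [hPn, hQn]
  ext
  · have e : (G (x, y)).1 = x + Q (x, y) := by simp [hQdef]
    simp only [e]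
    rw [← hk]
    field_simp
    ring
  · have e : (G (x, y)).2 = y - P (x, y) := by simp [hPdef]
    simp only [e]
    rw [← hk]
    field_simp
    ring
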